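/- arXiv:1006.3023 — 2 statements merged into one kernel-verified Lean document; each statement's English description precedes it below -/
import Mathlib

section
/- For a zero-dimensional Polish space X, the space C_k(X, 2) with the compact-open topology is sequential if and only if X is locally compact or the derived set X' (the set of non-isolated points of X) is compact. -/
open Set Filter Topology Metric

section General

variable {X : Type*} [TopologicalSpace X]

theorem ContinuousMap.setOf_eqOn_mem_nhds (f : C(X, Bool)) {K : Set X} (hK : IsCompact K) :
    {g : C(X, Bool) | EqOn g f K} ∈ 𝓝 f := by
  have hb : ∀ b : Bool, ∀ᶠ g : C(X, Bool) in 𝓝 f, MapsTo g (K ∩ f ⁻¹' {b}) {b} := fun b =>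
    ContinuousMap.eventually_mapsTo
      (hK.inter_right ((isClosed_discrete {b}).preimage f.continuous)) (isOpen_discrete _)
      fun _ hx => hx.2
  filter_upwards [hb true, hb false] with g ht hf x hx
  cases h : f x with
  | true => exact ht ⟨hx, h⟩
  | false => exact hf ⟨hx, h⟩

theorem ContinuousMap.eventually_apply_eq_of_tendsto {u : ℕ → C(X, Bool)} {f : C(X, Bool)}
    (hu : Tendsto u atTop (𝓝 f)) {x : ℕ → X} {a : X} (hx : Tendsto x atTop (𝓝 a)) :
    ∀ᶠ i in atTop, u i (x i) = f a := by
  have hfx : ∀ᶠ i in atTop, f (x i) = f a :=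
    ((f.continuous.tendsto a).comp hx).eventually
      (show ∀ᶠ b in 𝓝 (f a), b = f a by simp [nhds_discrete])
  filter_upwards [hu (f.setOf_eqOn_mem_nhds hx.isCompact_insert_range), hfx] with i hi hi'
  exact (hi (mem_insert_of_mem _ (mem_range_self i))).trans hi'

theorem exists_strictMono_const_of_not_tendsto_atTop {u : ℕ → ℕ}
    (hu : ¬ Tendsto u atTop atTop) : ∃ c, ∃ φ : ℕ → ℕ, StrictMono φ ∧ ∀ i, u (φ i) = c := by
  by_contra! h
  refine hu (Nat.cofinite_eq_atTop ▸ Tendsto.cofinite_of_finite_preimage_singleton fun c => ?_)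
  by_contra hc
  obtain ⟨φ, hφ, hφc⟩ := extraction_of_frequently_atTop
    (Nat.frequently_atTop_iff_infinite.2 hc : ∃ᶠ i in atTop, u i = c)
  exact (h c φ hφ).elim fun i hi => hi (hφc i)

theorem not_sequentialSpace_of_clopen_array {C : ℕ → ℕ → Set X} (hC : ∀ n m, IsClopen (C n m))
    {a : X} {w : ℕ → X} (ha : ∀ n m, a ∉ C n m) (hw : ∀ n m, w n ∉ C n m)
    (hrow : ∀ n, ∃ p : ℕ → X, (∀ m, p m ∈ C n m) ∧ Tendsto p atTop (𝓝 (w n)))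
    {y : ℕ → ℕ → X} (hy : ∀ n m, y n m ∈ C n m)
    (hya : ∀ n m : ℕ → ℕ, Tendsto n atTop atTop →
      Tendsto (fun i => y (n i) (m i)) atTop (𝓝 a))
    (hK : ∀ K : Set X, IsCompact K → ∃ n m, Disjoint (C n m) K) :
    ¬ SequentialSpace C(X, Bool) := by
  classical
  intro _
  let f : ℕ → ℕ → C(X, Bool) := fun n m =>
    ⟨fun x => decide (x ∈ C n m), (continuous_bool_rng true).2 (by
      convert hC n m using 1; ext; simp)⟩
  have hf : ∀ n m x, f n m x = true ↔ x ∈ C n m := fun n m x => decide_eq_true_iff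
  let A : Set C(X, Bool) := range fun q : ℕ × ℕ => f q.1 q.2
  have hcontra : ∀ {n m : ℕ → ℕ} {g : C(X, Bool)} {x : ℕ → X} {b : X},
      Tendsto (fun i => f (n i) (m i)) atTop (𝓝 g) → Tendsto x atTop (𝓝 b) →
      (∀ i, x i ∈ C (n i) (m i)) → (∀ i, b ∉ C (n i) (m i)) → False := by
    intro n m g x b hg hx hxC hb
    obtain ⟨i, h₁, h₂⟩ := ((ContinuousMap.eventually_apply_eq_of_tendsto hg hx).and
      (ContinuousMap.eventually_apply_eq_of_tendsto hg tendsto_const_nhds)).exists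
    exact hb i ((hf _ _ _).1 (h₂.trans (h₁.symm.trans ((hf _ _ _).2 (hxC i)))))
  have hA : IsSeqClosed A := by
    intro u g hu hg
    choose q hq using hu
    obtain rfl : (fun i => f (q i).1 (q i).2) = u := funext hq
    by_cases hn : Tendsto (fun i => (q i).1) atTop atTop
    · exact (hcontra hg (hya _ _ hn) (fun i => hy _ _) (fun i => ha _ _)).elim
    obtain ⟨c, φ, hφ, hc⟩ := exists_strictMono_const_of_not_tendsto_atTop hn
    have hgφ := hg.comp hφ.tendsto_atTop
    simp only [Function.comp_def, hc] at hgφ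
    by_cases hm : Tendsto (fun i => (q (φ i)).2) atTop atTop
    · obtain ⟨p, hp, hpw⟩ := hrow c
      exact (hcontra (n := fun _ => c) hgφ (hpw.comp hm) (fun i => hp _) (fun i => hw _ _)).elim
    obtain ⟨d, ψ, hψ, hd⟩ := exists_strictMono_const_of_not_tendsto_atTop hm
    have hgψ := hgφ.comp hψ.tendsto_atTop
    simp only [Function.comp_def, hd] at hgψ
    exact ⟨(c, d), tendsto_nhds_unique tendsto_const_nhds hgψ⟩
  have h0 : ContinuousMap.const X false ∈ closure A := by
    refine mem_closure_iff_nhds.2 fun t ht => ?_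
    have hb : (𝓝 false).HasBasis (fun _ : Unit => True) fun _ => {false} := by
      simpa [nhds_discrete] using hasBasis_pure false
    obtain ⟨⟨K, _⟩, ⟨hKc, -⟩, hKt⟩ := hb.nhds_continuousMapConst.mem_iff.1 ht
    obtain ⟨n, m, hd⟩ := hK K hKc
    exact ⟨f n m, hKt fun x hx => by simpa using (hf n m x).not.2 (hd.notMem_of_mem_right hx),
      ⟨(n, m), rfl⟩⟩
  rw [hA.isClosed.closure_eq] at h0
  obtain ⟨⟨n, m⟩, h⟩ := h0
  have := (hf n m _).2 (hy n m)
  rw [show f n m = _ from h] at this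
  simp at this

theorem exists_clopen_mem_subset_notMem [T1Space X]
    (hzd : TopologicalSpace.IsTopologicalBasis {s : Set X | IsClopen s}) {x a b : X} {U : Set X}
    (hU : U ∈ 𝓝 x) (ha : x ≠ a) (hb : x ≠ b) :
    ∃ s, IsClopen s ∧ x ∈ s ∧ s ⊆ U ∧ a ∉ s ∧ b ∉ s := by
  have h : U ∩ ({a}ᶜ ∩ {b}ᶜ) ∈ 𝓝 x :=
    inter_mem hU (inter_mem (isOpen_compl_singleton.mem_nhds ha)
      (isOpen_compl_singleton.mem_nhds hb))
  obtain ⟨s, hs, hxs, hsU⟩ := hzd.mem_nhds_iff.1 h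
  exact ⟨s, hs, hxs, fun y hy => (hsU hy).1, fun h => (hsU h).2.1 rfl, fun h => (hsU h).2.2 rfl⟩

theorem isOpen_singleton_of_notMem_closure_compl {x : X} (hx : x ∉ closure ({x}ᶜ : Set X)) :
    IsOpen ({x} : Set X) := by
  rw [closure_compl, notMem_compl_iff] at hx
  rw [← subset_interior_iff_isOpen]
  exact singleton_subset_iff.2 hx

theorem isClosed_setOf_mem_closure_compl_singleton :
    IsClosed {x : X | x ∈ closure ({x}ᶜ : Set X)} := by
  refine ⟨isOpen_iff_mem_nhds.2 fun x hx => mem_of_superset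
    ((isOpen_singleton_of_notMem_closure_compl hx).mem_nhds rfl) (singleton_subset_iff.2 hx)⟩

end General

section Metric

variable {X : Type*} [MetricSpace X]

theorem exists_seq_eventually_disjoint_ball_of_not_isCompact {S : Set X} (hS : IsClosed S)
    (hSc : ¬ IsCompact S) :
    ∃ x : ℕ → X, (∀ n, x n ∈ S) ∧ ∀ K : Set X, IsCompact K →
      ∀ᶠ n : ℕ in atTop, Disjoint (ball (x n) (1 / ((n : ℝ) + 1))) K := by
  replace hSc : ¬ IsSeqCompact S := fun h => hSc h.isCompact
  simp only [IsSeqCompact, not_forall] at hSc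
  obtain ⟨x, hxS, hx⟩ := hSc
  refine ⟨x, hxS, fun K hK => ?_⟩
  by_contra h
  obtain ⟨φ, hφ, hφK⟩ := extraction_of_frequently_atTop (not_eventually.1 h)
  simp only [not_disjoint_iff, mem_ball] at hφK
  choose z hzx hzK using hφK
  obtain ⟨a, -, ψ, hψ, hza⟩ := hK.tendsto_subseq hzK
  have hd : Tendsto (fun i => dist (z (ψ i)) (x (φ (ψ i)))) atTop (𝓝 0) :=
    squeeze_zero (fun _ => dist_nonneg) (fun i => (hzx (ψ i)).le)
      (tendsto_one_div_add_atTop_nhds_zero_nat.comp (hφ.comp hψ).tendsto_atTop)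
  have hxa : Tendsto (x ∘ (φ ∘ ψ)) atTop (𝓝 a) :=
    hza.congr_dist hd
  exact hx ⟨a, hS.mem_of_tendsto hxa (.of_forall fun i => hxS _), φ ∘ ψ, hφ.comp hψ, hxa⟩

theorem not_sequentialSpace_of_not_isCompact_derived
    (hzd : TopologicalSpace.IsTopologicalBasis {s : Set X | IsClopen s})
    (hX : ¬ LocallyCompactSpace X)
    (hD : ¬ IsCompact {x : X | x ∈ closure ({x}ᶜ : Set X)}) :
    ¬ SequentialSpace C(X, Bool) := by
  obtain ⟨a, ha⟩ : ∃ a : X, ∀ K, IsCompact K → K ∉ 𝓝 a := by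
    by_contra! h
    have : WeaklyLocallyCompactSpace X := ⟨h⟩
    exact hX inferInstance
  obtain ⟨w, hwD, hwK⟩ := exists_seq_eventually_disjoint_ball_of_not_isCompact
    (isClosed_setOf_mem_closure_compl_singleton (X := X)) hD
  have hε : ∀ n : ℕ, (0 : ℝ) < 1 / ((n : ℝ) + 1) := fun n => Nat.one_div_pos_of_nat
  -- clopen sets shrinking towards `w n`
  have hB : ∀ n m : ℕ, ∃ p : X, ∃ B : Set X, IsClopen B ∧ p ∈ B ∧
      B ⊆ ball (w n) (1 / ((n : ℝ) + 1)) ∧ a ∉ B ∧ w n ∉ B ∧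
      p ∈ ball (w n) (1 / ((m : ℝ) + 1)) := by
    intro n m
    have hne : (𝓝[≠] (w n)).NeBot := mem_closure_iff_nhdsWithin_neBot.1 (hwD n)
    have hev : ∀ᶠ p in 𝓝[≠] (w n), p ≠ w n ∧ p ≠ a ∧ p ∈ ball (w n) (1 / ((n : ℝ) + 1)) ∧
        p ∈ ball (w n) (1 / ((m : ℝ) + 1)) := by
      refine eventually_mem_nhdsWithin.and (.and ?_ (.and ?_ ?_))
      · rcases eq_or_ne (w n) a with h | h
        · exact h ▸ eventually_mem_nhdsWithin
        · exact eventually_ne_nhdsWithin h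
      · exact mem_nhdsWithin_of_mem_nhds (ball_mem_nhds _ (hε n))
      · exact mem_nhdsWithin_of_mem_nhds (ball_mem_nhds _ (hε m))
    obtain ⟨p, hpw, hpa, hpn, hpm⟩ := hev.exists
    obtain ⟨B, hB, hpB, hBn, haB, hwB⟩ :=
      exists_clopen_mem_subset_notMem hzd (isOpen_ball.mem_nhds hpn) hpa hpw
    exact ⟨p, B, hB, hpB, hBn, haB, hwB, hpm⟩
  choose p B hBclopen hpB hBball haB hwB hpball using hB
  -- clopen sets escaping every compact set, near `a`
  have hP : ∀ n : ℕ, ∃ (y : ℕ → X) (P : ℕ → Set X), ∀ m, IsClopen (P m) ∧ y m ∈ P m ∧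
      a ∉ P m ∧ w n ∉ P m ∧ y m ∈ ball a (1 / ((n : ℝ) + 1)) ∧
      ∀ K, IsCompact K → ∀ᶠ m in atTop, Disjoint (P m) K := by
    intro n
    obtain ⟨U, hU, haU, hUball⟩ := hzd.mem_nhds_iff.1 (ball_mem_nhds a (hε n))
    have hUc : ¬ IsCompact U := fun h => ha U h (hU.isOpen.mem_nhds haU)
    obtain ⟨x, hxU, hxK⟩ := exists_seq_eventually_disjoint_ball_of_not_isCompact hU.isClosed hUc
    obtain ⟨N, hN⟩ := eventually_atTop.1 (hxK {a, w n} (toFinite _).isCompact)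
    have hx : ∀ m, x (m + N) ≠ a ∧ x (m + N) ≠ w n := fun m => by
      have h := (hN (m + N) (by omega)).notMem_of_mem_left (mem_ball_self (hε _))
      simpa using h
    have hP : ∀ m, ∃ s, IsClopen s ∧ x (m + N) ∈ s ∧
        s ⊆ ball (x (m + N)) (1 / (((m + N : ℕ) : ℝ) + 1)) ∧ a ∉ s ∧ w n ∉ s := fun m =>
      exists_clopen_mem_subset_notMem hzd (ball_mem_nhds _ (hε _)) (hx m).1 (hx m).2
    choose P hPc hxP hPball haP hwP using hP
    refine ⟨fun m => x (m + N), P, fun m => ⟨hPc m, hxP m, haP m, hwP m, hUball (hxU _), ?_⟩⟩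
    intro K hK
    filter_upwards [(tendsto_add_atTop_nat N).eventually (hxK K hK)] with m hm
    exact hm.mono_left (hPball m)
  choose y P hP using hP
  refine not_sequentialSpace_of_clopen_array (C := fun n m => P n m ∪ B n m) (a := a) (w := w)
    (y := y) (fun n m => (hP n m).1.union (hBclopen n m)) (fun n m => ?_) (fun n m => ?_)
    (fun n => ⟨p n, fun m => .inr (hpB n m), ?_⟩) (fun n m => .inl (hP n m).2.1)
    (fun n m hn => ?_) (fun K hK => ?_)
  · exact fun h => h.elim (hP n m).2.2.1 (haB n m)
  · exact fun h => h.elim (hP n m).2.2.2.1 (hwB n m)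
  · exact tendsto_iff_dist_tendsto_zero.2 <| squeeze_zero (fun _ => dist_nonneg)
      (fun m => (hpball n m).le) tendsto_one_div_add_atTop_nhds_zero_nat
  · exact tendsto_iff_dist_tendsto_zero.2 <| squeeze_zero (fun _ => dist_nonneg)
      (fun i => (hP (n i) (m i)).2.2.2.2.1.le) (tendsto_one_div_add_atTop_nhds_zero_nat.comp hn)
  · obtain ⟨n, hn⟩ := (hwK K hK).exists
    obtain ⟨m, hm⟩ := ((hP n 0).2.2.2.2.2 K hK).exists
    exact ⟨n, m, hm.union_left (hn.mono_left (hBball n m))⟩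

theorem IsCompact.exists_monotone_isClosed_exhaustion_compl {D : Set X} (hD : IsCompact D) :
    ∃ L : ℕ → Set X, Monotone L ∧ L 0 = ∅ ∧ (∀ n, IsClosed (L n)) ∧ (∀ n, Disjoint (L n) D) ∧
      ∀ O, IsOpen O → D ⊆ O → ∃ n, (L n)ᶜ ⊆ O := by
  have hε : ∀ n : ℕ, (0 : ℝ) < 1 / ((n : ℝ) + 1) := fun n => Nat.one_div_pos_of_nat
  refine ⟨fun n => n.casesOn ∅ fun k => (thickening (1 / ((k : ℝ) + 1)) D)ᶜ, ?_, rfl, ?_, ?_, ?_⟩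
  · refine monotone_nat_of_le_succ fun n => ?_
    cases n with
    | zero => exact empty_subset _
    | succ k =>
      refine compl_subset_compl.2 (thickening_mono ?_ D)
      exact one_div_le_one_div_of_le (by positivity) (by push_cast; linarith)
  · rintro (_ | k)
    · exact isClosed_empty
    · exact isOpen_thickening.isClosed_compl
  · rintro (_ | k)
    · exact empty_disjoint _
    · exact disjoint_compl_left_iff_subset.2 (self_subset_thickening (hε k) D)
  · intro O hO hDO
    obtain ⟨δ, hδ, hδO⟩ := hD.exists_thickening_subset_open hO hDO
    obtain ⟨k, hk⟩ := exists_nat_one_div_lt hδ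
    refine ⟨k + 1, ?_⟩
    simpa using (thickening_mono hk.le D).trans hδO

end Metric

section Exhaustion

variable {X : Type*} [TopologicalSpace X]

theorem isCompact_union_iUnion_of_finite {D : Set X} (hD : IsCompact D) {L : ℕ → Set X}
    (hLO : ∀ O, IsOpen O → D ⊆ O → ∃ n, (L n)ᶜ ⊆ O) {F : ℕ → Set X} (hF : ∀ n, (F n).Finite)
    (hFL : ∀ n k, F k ⊆ F n ∪ (L n)ᶜ) : IsCompact (D ∪ ⋃ n, F n) := by
  refine isCompact_of_finite_subcover fun {ι} U hU hcov => ?_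
  obtain ⟨s, hs⟩ := hD.elim_finite_subcover U hU (subset_union_left.trans hcov)
  obtain ⟨n, hn⟩ := hLO _ (isOpen_biUnion fun i _ => hU i) hs
  obtain ⟨t, ht⟩ := (hF n).isCompact.elim_finite_subcover U hU
    ((subset_iUnion F n).trans (subset_union_right.trans hcov))
  classical
  refine ⟨s ∪ t, ?_⟩
  rw [Finset.set_biUnion_union]
  refine union_subset (hs.trans subset_union_left) (iUnion_subset fun k => ?_)
  exact (hFL n k).trans (union_subset (ht.trans subset_union_right) (hn.trans subset_union_left))

theorem IsSeqClosed.isCompact_inter_setOf_eqOn_compl [SecondCountableTopology X]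
    {A : Set C(X, Bool)} (hA : IsSeqClosed A) (f : C(X, Bool)) {L : Set X} (hL : IsClosed L)
    (hLo : ∀ x ∈ L, IsOpen ({x} : Set X)) :
    IsCompact (A ∩ {g : C(X, Bool) | EqOn g f Lᶜ}) := by
  classical
  have hdisc : DiscreteTopology L := discreteTopology_iff_isOpen_singleton.2 fun x => by
    convert! (hLo x x.2).preimage continuous_subtype_val using 1
    ext y
    simp [Subtype.ext_iff]
  have hcount : Countable L := TopologicalSpace.separableSpace_iff_countable.1 inferInstance
  let φ : (L → Bool) → X → Bool := fun S x => if h : x ∈ L then S ⟨x, h⟩ else f x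
  have hφ : Continuous (Function.uncurry φ) := by
    refine continuous_iff_continuousAt.2 fun ⟨S, x⟩ => ?_
    by_cases hx : x ∈ L
    · have hev : (fun q : (L → Bool) × X => q.1 ⟨x, hx⟩) =ᶠ[𝓝 (S, x)] Function.uncurry φ := by
        filter_upwards [(continuous_snd.tendsto (S, x)).eventually ((hLo x hx).mem_nhds rfl)]
          with ⟨T, z⟩ hz
        obtain rfl : z = x := hz
        simp [φ, Function.uncurry, hx]
      exact ContinuousAt.congr (by fun_prop) hev
    · have hev : (fun q : (L → Bool) × X => f q.2) =ᶠ[𝓝 (S, x)] Function.uncurry φ := by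
        filter_upwards [(continuous_snd.tendsto (S, x)).eventually
          (hL.isOpen_compl.mem_nhds hx)] with ⟨T, z⟩ hz
        have hz' : z ∉ L := hz
        simp [φ, Function.uncurry, hz']
      exact ContinuousAt.congr (by fun_prop) hev
  let Φ : (L → Bool) → C(X, Bool) := fun S => ⟨φ S, hφ.comp (.prodMk_right S)⟩
  have hΦ : Continuous Φ := ContinuousMap.continuous_of_continuous_uncurry Φ hφ
  have hc : IsCompact (Φ ⁻¹' A) := (hA.preimage hΦ.seqContinuous).isClosed.isCompact
  convert hc.image hΦ using 1
  ext g
  constructor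
  · rintro ⟨hgA, hg⟩
    have hgΦ : Φ (fun x => g x) = g := by
      ext x
      by_cases hx : x ∈ L
      · simp [Φ, φ, hx]
      · simpa [Φ, φ, hx] using (hg hx).symm
    exact ⟨fun x => g x, by rwa [mem_preimage, hgΦ], hgΦ⟩
  · rintro ⟨S, hS, rfl⟩
    exact ⟨hS, fun x hx => dif_neg hx⟩

theorem exists_finite_separating_succ {A : Set C(X, Bool)} {f : C(X, Bool)} {L L' F : Set X}
    (hc : IsCompact (A ∩ {g : C(X, Bool) | EqOn g f L'ᶜ}))
    (hF : ∀ g ∈ A, EqOn g f Lᶜ → ¬ EqOn g f F) :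
    ∃ G : Set X, G.Finite ∧ G ⊆ Lᶜ ∧ ∀ g ∈ A, EqOn g f L'ᶜ → ¬ EqOn g f (F ∪ G) := by
  have hev : ∀ x : X, Continuous fun g : C(X, Bool) => g x := continuous_eval_const
  have hcl : IsClosed {g : C(X, Bool) | EqOn g f F} := by
    simp only [EqOn, ofPred_forall]
    exact isClosed_biInter fun x _ => isClosed_eq (hev x) continuous_const
  obtain ⟨G, hGL, hGfin, hG⟩ := (hc.inter_right hcl).elim_finite_subcover_image (b := Lᶜ)
    (c := fun x => {g : C(X, Bool) | g x ≠ f x})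
    (fun x _ => (isOpen_discrete {b | b ≠ f x}).preimage (hev x)) (by
      rintro g ⟨⟨hgA, -⟩, hgF⟩
      have h := mt (hF g hgA) (not_not.2 hgF)
      simpa [EqOn] using h)
  refine ⟨G, hGfin, hGL, fun g hgA hgL hgFG => ?_⟩
  obtain ⟨x, hx, hne⟩ := mem_iUnion₂.1
    (hG ⟨⟨hgA, hgL⟩, hgFG.mono subset_union_left⟩)
  exact hne (hgFG (.inr hx))

theorem sequentialSpace_of_exhaustion [SecondCountableTopology X] {D : Set X} (hD : IsCompact D)
    (hDo : ∀ x ∉ D, IsOpen ({x} : Set X)) {L : ℕ → Set X} (hLmono : Monotone L)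
    (hL0 : L 0 = ∅) (hLc : ∀ n, IsClosed (L n)) (hLD : ∀ n, Disjoint (L n) D)
    (hLO : ∀ O, IsOpen O → D ⊆ O → ∃ n, (L n)ᶜ ⊆ O) : SequentialSpace C(X, Bool) := by
  refine ⟨fun A hA => isClosed_of_closure_subset fun f hf => ?_⟩
  by_contra hfA
  let Sep : ℕ → Set X → Prop := fun n F =>
    F.Finite ∧ ∀ g ∈ A, EqOn g f (L n)ᶜ → ¬ EqOn g f F
  have hzero : Sep 0 ∅ := by
    refine ⟨finite_empty, fun g hgA hg => (hfA ?_).elim⟩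
    rw [hL0, compl_empty, eqOn_univ] at hg
    rwa [← DFunLike.coe_injective hg]
  have hstep : ∀ n (F : {F // Sep n F}), ∃ F' : {F // Sep (n + 1) F},
      F.1 ⊆ F'.1 ∧ F'.1 ⊆ F.1 ∪ (L n)ᶜ := by
    rintro n ⟨F, hFfin, hF⟩
    obtain ⟨G, hGfin, hGL, hG⟩ := exists_finite_separating_succ
      (hA.isCompact_inter_setOf_eqOn_compl f (hLc (n + 1)) fun x hx =>
        hDo x ((hLD (n + 1)).notMem_of_mem_left hx)) hF
    exact ⟨⟨F ∪ G, hFfin.union hGfin, hG⟩, subset_union_left, union_subset_union_right F hGL⟩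
  choose next hnext_sup hnext_sub using hstep
  let F : ∀ n, {F // Sep n F} := fun n => Nat.rec ⟨∅, hzero⟩ next n
  have hFmono : Monotone fun n => (F n).1 := monotone_nat_of_le_succ fun n => hnext_sup n (F n)
  have hFL : ∀ n k, (F k).1 ⊆ (F n).1 ∪ (L n)ᶜ := by
    intro n k
    induction k with
    | zero => exact empty_subset _
    | succ k ih =>
      rcases le_or_gt n k with h | h
      · exact (hnext_sub k (F k)).trans
          (union_subset ih ((compl_subset_compl.2 (hLmono h)).trans subset_union_right))
      · exact (hFmono h).trans subset_union_left
  have hK := isCompact_union_iUnion_of_finite hD hLO (fun n => (F n).2.1) hFL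
  obtain ⟨g, hg, hgA⟩ := mem_closure_iff_nhds.1 hf _ (f.setOf_eqOn_mem_nhds hK)
  obtain ⟨n, hn⟩ := hLO {x | g x = f x}
    ((isOpen_discrete {q : Bool × Bool | q.1 = q.2}).preimage (g.continuous.prodMk f.continuous))
    fun x hx => hg (.inl hx)
  exact (F n).2.2 g hgA (fun x hx => hn hx) fun x hx => hg (.inr (mem_iUnion_of_mem n hx))

end Exhaustion

/-- For a zero-dimensional Polish space `X`, the space `C_k(X, 2)` of continuous maps
to the discrete two-point space with the compact-open topology is sequential iff
`X` is locally compact or the derived set of `X` (the set of non-isolated points)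
is compact. -/
theorem Ck_two_sequential_iff
    (X : Type*) [TopologicalSpace X] [PolishSpace X]
    (hzd : TopologicalSpace.IsTopologicalBasis {s : Set X | IsClopen s}) :
    SequentialSpace C(X, Bool) ↔
      LocallyCompactSpace X ∨ IsCompact {x : X | x ∈ closure ({x}ᶜ : Set X)} := by
  let := TopologicalSpace.metrizableSpaceMetric X
  constructor
  · intro h
    by_contra! hX
    exact not_sequentialSpace_of_not_isCompact_derived hzd hX.1 hX.2 h
  · rintro (h | h)
    · infer_instance
    · obtain ⟨L, hLmono, hL0, hLc, hLD, hLO⟩ := h.exists_monotone_isClosed_exhaustion_compl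
      exact sequentialSpace_of_exhaustion h
        (fun x hx => isOpen_singleton_of_notMem_closure_compl hx) hLmono hL0 hLc hLD hLO
end

section
/- If X is a metrizable space that is not locally compact, then C_k(X) (real-valued continuous functions with the compact-open topology) contains a closed copy of the Arens space S_2, and hence C_k(X) is not sequential at any point where S_2 embeds; in particular C_k(X) does not have the property AP. -/
open Filter

/-- The underlying set of the Arens space `S₂`: a point `∞ = none`, the points
`aₙ = some (inl n)` of a sequence converging to `∞`, and for each `n` a sequence
`aₙₖ = some (inr (n, k))` converging to `aₙ`. -/
def ArensSpace : Type := Option (ℕ ⊕ (ℕ × ℕ))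

/-- The Arens topology: the `aₙₖ` are isolated; a set containing `aₙ` must contain a
tail of its column to be open; a set containing `∞` must contain a tail of the `aₙ`. -/
instance : TopologicalSpace ArensSpace where
  IsOpen U :=
    (∀ n : ℕ, some (Sum.inl n) ∈ U → ∀ᶠ k in atTop, some (Sum.inr (n, k)) ∈ U) ∧
    (none ∈ U → ∀ᶠ n in atTop, some (Sum.inl n) ∈ U)
  isOpen_univ := ⟨fun _ _ => Eventually.of_forall fun _ => Set.mem_univ _,
    fun _ => Eventually.of_forall fun _ => Set.mem_univ _⟩
  isOpen_inter := by
    rintro U V ⟨hU₁, hU₂⟩ ⟨hV₁, hV₂⟩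
    exact ⟨fun n hn => (hU₁ n hn.1).and (hV₁ n hn.2),
      fun hn => (hU₂ hn.1).and (hV₂ hn.2)⟩
  isOpen_sUnion := by
    intro S hS
    constructor
    · rintro n ⟨U, hU, hnU⟩
      exact ((hS U hU).1 n hnU).mono fun k hk => ⟨U, hU, hk⟩
    · rintro ⟨U, hU, hnU⟩
      exact ((hS U hU).2 hnU).mono fun n hn => ⟨U, hU, hn⟩

/-- Property AP (approximation by points): for every set `A` and every point
`x ∈ cl(A) \ A` there is `B ⊆ A` with `cl(B) = B ∪ {x}`. -/
def HasPropertyAP (Y : Type*) [TopologicalSpace Y] : Prop :=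
  ∀ A : Set Y, ∀ x ∈ closure A, x ∉ A → ∃ B ⊆ A, closure B = B ∪ {x}

open Topology Set

namespace ArensSpace

/-- The point `∞` of the Arens space. -/
def infty : ArensSpace := none

/-- The points `aₙ` converging to `∞`. -/
def node (n : ℕ) : ArensSpace := some (Sum.inl n)

/-- The isolated points `aₙₖ`, converging to `aₙ` as `k → ∞`. -/
def leaf (n k : ℕ) : ArensSpace := some (Sum.inr (n, k))

theorem eq_infty_or_node_or_leaf (p : ArensSpace) :
    p = infty ∨ (∃ n, p = node n) ∨ ∃ n k, p = leaf n k := by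
  rcases p with _ | n | ⟨n, k⟩
  · exact Or.inl rfl
  · exact Or.inr (Or.inl ⟨n, rfl⟩)
  · exact Or.inr (Or.inr ⟨n, k, rfl⟩)

theorem infty_ne_leaf (n k : ℕ) : infty ≠ leaf n k := fun h => by cases h

theorem node_ne_leaf (m n k : ℕ) : node m ≠ leaf n k := fun h => by cases h

theorem isOpen_iff {U : Set ArensSpace} :
    IsOpen U ↔ (∀ n, node n ∈ U → ∀ᶠ k in atTop, leaf n k ∈ U) ∧
      (infty ∈ U → ∀ᶠ n in atTop, node n ∈ U) :=
  Iff.rfl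

theorem tendsto_leaf (n : ℕ) : Tendsto (leaf n) atTop (𝓝 (node n)) := by
  refine tendsto_nhds.2 fun U hU hn => ?_
  exact (isOpen_iff.1 hU).1 n hn

theorem tendsto_node : Tendsto node atTop (𝓝 infty) := by
  refine tendsto_nhds.2 fun U hU hn => ?_
  exact (isOpen_iff.1 hU).2 hn

theorem continuous_of_tendsto {Y : Type*} [TopologicalSpace Y] {e : ArensSpace → Y}
    (hleaf : ∀ n, Tendsto (fun k => e (leaf n k)) atTop (𝓝 (e (node n))))
    (hnode : Tendsto (fun n => e (node n)) atTop (𝓝 (e infty))) : Continuous e := by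
  refine continuous_def.2 fun U hU => isOpen_iff.2 ⟨fun n hn => ?_, fun h => ?_⟩
  · exact (hleaf n).eventually (hU.mem_nhds hn)
  · exact hnode.eventually (hU.mem_nhds h)

/-- The union of the columns with index less than `N`. -/
def columnsBelow (N : ℕ) : Set ArensSpace :=
  ⋃ n ∈ Iio N, insert (node n) (range (leaf n))

theorem isCompact_columnsBelow (N : ℕ) : IsCompact (columnsBelow N) :=
  (finite_Iio N).isCompact_biUnion fun n _ => (tendsto_leaf n).isCompact_insert_range

theorem node_mem_columnsBelow {n N : ℕ} (h : n < N) : node n ∈ columnsBelow N :=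
  mem_biUnion (mem_Iio.2 h) (mem_insert _ _)

theorem leaf_mem_columnsBelow {n N : ℕ} (k : ℕ) (h : n < N) : leaf n k ∈ columnsBelow N :=
  mem_biUnion (mem_Iio.2 h) (mem_insert_of_mem _ (mem_range_self k))

theorem infty_mem_closure_leaves : infty ∈ closure {p | ∃ n k, p = leaf n k} := by
  refine isClosed_closure.mem_of_tendsto tendsto_node (Eventually.of_forall fun n => ?_)
  exact mem_closure_of_tendsto (tendsto_leaf n) (Eventually.of_forall fun k => ⟨n, k, rfl⟩)

theorem not_hasPropertyAP : ¬ HasPropertyAP ArensSpace := by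
  intro h
  obtain ⟨B, hB, hcl⟩ := h {p | ∃ n k, p = leaf n k} infty infty_mem_closure_leaves
    (by rintro ⟨n, k, h⟩; exact infty_ne_leaf n k h)
  have hinf : infty ∉ B := fun h => by
    obtain ⟨n, k, h⟩ := hB h
    exact infty_ne_leaf n k h
  have hnode (n : ℕ) : node n ∉ B := fun h => by
    obtain ⟨m, k, h⟩ := hB h
    exact node_ne_leaf n m k h
  have hnode_cl (n : ℕ) : node n ∉ closure B := by
    rw [hcl]
    rintro (h | h)
    · exact hnode n h
    · cases h
  have hclosed : IsClosed B := by
    refine ⟨isOpen_iff.2 ⟨fun n _ => ?_, fun _ => Eventually.of_forall hnode⟩⟩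
    filter_upwards [(tendsto_leaf n).eventually
      (isClosed_closure.isOpen_compl.mem_nhds (hnode_cl n))] with k hk hkB
    exact hk (subset_closure hkB)
  refine hinf ?_
  rw [← hclosed.closure_eq, hcl]
  exact Or.inr rfl

end ArensSpace

theorem HasPropertyAP.of_isClosedEmbedding {Y Z : Type*} [TopologicalSpace Y]
    [TopologicalSpace Z] (hZ : HasPropertyAP Z) {e : Y → Z} (he : IsClosedEmbedding e) :
    HasPropertyAP Y := by
  intro A x hx hxA
  obtain ⟨B, hBA, hB⟩ := hZ (e '' A) (e x)
    (image_closure_subset_closure_image he.continuous (mem_image_of_mem e hx))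
    (by rwa [he.injective.mem_set_image])
  obtain ⟨C, hCA, rfl⟩ := subset_image_iff.1 hBA
  refine ⟨C, hCA, he.injective.image_injective ?_⟩
  rw [← he.closure_image_eq, hB, image_union, image_singleton]

/-- The map from the Arens space to `C(X, ℝ)` sending `∞` to `0`, `aₙ` to the constant
`1 / (n + 1)` and `aₙₖ` to `1 / (n + 1) + u n k`. -/
noncomputable def arensMap {X : Type*} [TopologicalSpace X] (u : ℕ → ℕ → C(X, ℝ)) :
    ArensSpace → C(X, ℝ)
  | none => 0
  | some (Sum.inl n) => ContinuousMap.const X (1 / ((n : ℝ) + 1))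
  | some (Sum.inr (n, k)) => ContinuousMap.const X (1 / ((n : ℝ) + 1)) + u n k

section arensMap

open ArensSpace

variable {X : Type*} [TopologicalSpace X] {u : ℕ → ℕ → C(X, ℝ)}

@[simp]
theorem arensMap_infty : arensMap u infty = 0 := rfl

@[simp]
theorem arensMap_node (n : ℕ) :
    arensMap u (node n) = ContinuousMap.const X (1 / ((n : ℝ) + 1)) := rfl

@[simp]
theorem arensMap_leaf (n k : ℕ) :
    arensMap u (leaf n k) = ContinuousMap.const X (1 / ((n : ℝ) + 1)) + u n k := rfl

theorem continuous_arensMap (hu : ∀ n, Tendsto (u n) atTop (𝓝 0)) :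
    Continuous (arensMap u) := by
  refine continuous_of_tendsto (fun n => ?_) ?_
  · simpa using (hu n).const_add (ContinuousMap.const X (1 / ((n : ℝ) + 1)))
  · have h := (ContinuousMap.continuous_const' (X := X) (Y := ℝ)).tendsto 0 |>.comp
      (tendsto_one_div_add_atTop_nhds_zero_nat (𝕜 := ℝ))
    exact h

/-- Injectivity is read off from the values at `x₀`, which determine the column, and from the
peaks of the functions `u n k`. -/
theorem injective_arensMap {x₀ : X} (hx₀ : ∀ n k, u n k x₀ = 0) {x : ℕ → ℕ → X}
    (hpeak : ∀ n k, u n k (x n k) = k + 1) (hle : ∀ n k y, u n k y ≤ k + 1) :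
    Function.Injective (arensMap u) := by
  have hpos (n : ℕ) : (0 : ℝ) < 1 / ((n : ℝ) + 1) := by positivity
  have hcol {m n : ℕ} (h : 1 / ((m : ℝ) + 1) = 1 / ((n : ℝ) + 1)) : m = n := by
    simpa using h
  intro p q h
  have h₀ := DFunLike.congr_fun h x₀
  rcases eq_infty_or_node_or_leaf p with rfl | ⟨m, rfl⟩ | ⟨m, j, rfl⟩ <;>
    rcases eq_infty_or_node_or_leaf q with rfl | ⟨n, rfl⟩ | ⟨n, k, rfl⟩ <;>
    simp only [arensMap_infty, arensMap_node, arensMap_leaf, ContinuousMap.zero_apply,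
      ContinuousMap.const_apply, ContinuousMap.add_apply, hx₀, add_zero] at h₀
  · rfl
  · exact absurd h₀ (hpos n).ne
  · exact absurd h₀ (hpos n).ne
  · exact absurd h₀ (hpos m).ne'
  · rw [hcol h₀]
  · obtain rfl := hcol h₀
    have h₁ := DFunLike.congr_fun h (x m k)
    simp [hpeak] at h₁
    exact absurd h₁ (by positivity)
  · exact absurd h₀ (hpos m).ne'
  · obtain rfl := hcol h₀
    have h₁ := DFunLike.congr_fun h (x m j)
    simp [hpeak] at h₁
    exact absurd h₁ (by positivity)
  · obtain rfl := hcol h₀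
    have h₁ := DFunLike.congr_fun h (x m j)
    have h₂ := DFunLike.congr_fun h (x m k)
    simp only [arensMap_leaf, ContinuousMap.add_apply, ContinuousMap.const_apply, hpeak,
      add_right_inj] at h₁ h₂
    have h₃ := hle m k (x m j)
    have h₄ := hle m j (x m k)
    have : (j : ℝ) = k := by linarith
    rw [Nat.cast_injective this]

end arensMap

theorem isCompact_insert_image_of_finite_columns {X : Type*} [TopologicalSpace X] {x₀ : X}
    {x : ℕ → ℕ → X} (hx : ∀ U ∈ 𝓝 x₀, ∀ᶠ n in atTop, ∀ k, x n k ∈ U) {S : Set (ℕ × ℕ)}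
    (hS : ∀ n, {k | (n, k) ∈ S}.Finite) :
    IsCompact (insert x₀ ((fun p : ℕ × ℕ => x p.1 p.2) '' S)) := by
  have hlim : Tendsto (fun p : S => x p.1.1 p.1.2) cofinite (𝓝 x₀) := by
    intro U hU
    obtain ⟨N, hN⟩ := eventually_atTop.1 (hx U hU)
    have hfin : (⋃ n ∈ Iio N, Prod.mk n '' {k | (n, k) ∈ S}).Finite :=
      (finite_Iio N).biUnion fun n _ => (hS n).image _
    refine mem_cofinite.2 ((hfin.preimage Subtype.val_injective.injOn).subset ?_)
    rintro ⟨⟨n, k⟩, hp⟩ hnot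
    refine mem_biUnion (mem_Iio.2 (lt_of_not_ge fun hle => hnot (hN n hle k))) ⟨k, hp, rfl⟩
  have h := hlim.isCompact_insert_range_of_cofinite
  rwa [image_eq_range]

section closedMap

open ArensSpace

variable {X : Type*} [TopologicalSpace X] {u : ℕ → ℕ → C(X, ℝ)}

theorem isClosedMap_arensMap (hu : ∀ n, Tendsto (u n) atTop (𝓝 0))
    (hzero : ∀ y, ∀ᶠ n in atTop, ∀ k, u n k y = 0) {x₀ : X} {x : ℕ → ℕ → X}
    (hx : ∀ U ∈ 𝓝 x₀, ∀ᶠ n in atTop, ∀ k, x n k ∈ U)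
    (hpeak : ∀ n k, u n k (x n k) = k + 1) : IsClosedMap (arensMap u) := by
  have hcont := continuous_arensMap hu
  intro F hF
  refine closure_subset_iff_isClosed.1 fun g hg => ?_
  by_contra hgF
  have htail (N : ℕ) : g ∈ closure (arensMap u '' (F \ columnsBelow N)) := by
    rw [← inter_union_sdiff F (columnsBelow N), image_union, closure_union] at hg
    refine hg.resolve_left fun h => hgF ?_
    have hcomp := ((isCompact_columnsBelow N).inter_left hF).image hcont
    rw [hcomp.isClosed.closure_eq] at h
    exact image_mono inter_subset_left h
  have hg0 : g = 0 := by
    ext y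
    have hle : ∀ᶠ N : ℕ in atTop, g y ∈ Icc 0 (1 / ((N : ℝ) + 1)) := by
      obtain ⟨M, hM⟩ := eventually_atTop.1 (hzero y)
      filter_upwards [eventually_ge_atTop M] with N hN
      have hclosed : IsClosed {h : C(X, ℝ) | h y ∈ Icc 0 (1 / ((N : ℝ) + 1))} :=
        isClosed_Icc.preimage (continuous_eval_const y)
      refine closure_minimal ?_ hclosed (htail N)
      rintro _ ⟨p, ⟨-, hp⟩, rfl⟩
      rcases eq_infty_or_node_or_leaf p with rfl | ⟨n, rfl⟩ | ⟨n, k, rfl⟩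
      · exact ⟨le_rfl, by simp only [arensMap_infty, ContinuousMap.zero_apply]; positivity⟩
      · have hn : N ≤ n := not_lt.1 fun h => hp (node_mem_columnsBelow h)
        exact ⟨by simp only [arensMap_node, ContinuousMap.const_apply]; positivity,
          Nat.one_div_le_one_div hn⟩
      · have hn : N ≤ n := not_lt.1 fun h => hp (leaf_mem_columnsBelow k h)
        simp only [mem_ofPred_eq, arensMap_leaf, ContinuousMap.add_apply,
          ContinuousMap.const_apply, hM n (hN.trans hn) k, add_zero]
        exact ⟨by positivity, Nat.one_div_le_one_div hn⟩
    refine le_antisymm (ge_of_tendsto tendsto_one_div_add_atTop_nhds_zero_nat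
      (hle.mono fun N hN => hN.2)) ?_
    obtain ⟨N, hN⟩ := hle.exists
    exact hN.1
  subst hg0
  have hinf : infty ∉ F := fun h => hgF ⟨infty, h, rfl⟩
  obtain ⟨hleaf, hnode⟩ := isOpen_iff.1 hF.isOpen_compl
  obtain ⟨N, hN⟩ := eventually_atTop.1 (hnode hinf)
  have hcol (n : ℕ) : {k | (n, k) ∈ {p : ℕ × ℕ | N ≤ p.1 ∧ leaf p.1 p.2 ∈ F}}.Finite := by
    by_cases hn : N ≤ n
    · have h := hleaf n (hN n hn)
      rw [← Nat.cofinite_eq_atTop] at h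
      refine h.subset fun k hk hkF => hkF hk.2
    · simp [hn]
  have hK := isCompact_insert_image_of_finite_columns hx hcol
  have hopen := ContinuousMap.isOpen_setOfPred_mapsTo hK (isOpen_Iio (a := (1 : ℝ)))
  obtain ⟨_, hlt, p, ⟨hpF, hp⟩, rfl⟩ := mem_closure_iff.1 (htail N) _ hopen
    fun y _ => by simp
  rcases eq_infty_or_node_or_leaf p with rfl | ⟨n, rfl⟩ | ⟨n, k, rfl⟩
  · exact hinf hpF
  · exact hN n (not_lt.1 fun h => hp (node_mem_columnsBelow h)) hpF
  · have hn : N ≤ n := not_lt.1 fun h => hp (leaf_mem_columnsBelow k h)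
    have h : arensMap u (leaf n k) (x n k) < 1 :=
      hlt (mem_insert_of_mem _ ⟨(n, k), ⟨hn, hpF⟩, rfl⟩)
    simp only [arensMap_leaf, ContinuousMap.add_apply, ContinuousMap.const_apply, hpeak] at h
    have : (0 : ℝ) < 1 / ((n : ℝ) + 1) := by positivity
    have : (0 : ℝ) ≤ k := by positivity
    linarith

end closedMap

/-- The tent function of height `h` centred at `c` and supported in the ball of radius `r`. -/
noncomputable def tent {X : Type*} [PseudoMetricSpace X] (h r : ℝ) (c : X) : C(X, ℝ) where
  toFun y := h * max 0 (1 - dist y c / r)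
  continuous_toFun := by fun_prop

section tent

variable {X : Type*} [PseudoMetricSpace X] {h r : ℝ} {c y : X}

theorem tent_apply : tent h r c y = h * max 0 (1 - dist y c / r) := rfl

theorem tent_self : tent h r c c = h := by simp [tent_apply]

theorem tent_le (hh : 0 ≤ h) (hr : 0 ≤ r) : tent h r c y ≤ h := by
  have : 0 ≤ dist y c / r := by positivity
  exact mul_le_of_le_one_right hh (max_le zero_le_one (by linarith))

theorem tent_eq_zero (hr : 0 < r) (hy : r ≤ dist y c) : tent h r c y = 0 := by
  have : 1 ≤ dist y c / r := (one_le_div hr).2 hy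
  rw [tent_apply, max_eq_left (by linarith), mul_zero]

theorem tendsto_tent_zero {c : ℕ → X} {h r : ℕ → ℝ} (hr : ∀ k, 0 < r k)
    (hr0 : Tendsto r atTop (𝓝 0))
    (hc : ∀ y, ∃ ε > 0, ∀ᶠ k in atTop, ε ≤ dist (c k) y) :
    Tendsto (fun k => tent (h k) (r k) (c k)) atTop (𝓝 0) := by
  refine ContinuousMap.tendsto_of_tendstoLocallyUniformly ?_
  intro V hV y
  obtain ⟨ε, hε, hev⟩ := hc y
  refine ⟨Metric.ball y (ε / 2), Metric.ball_mem_nhds y (half_pos hε), ?_⟩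
  filter_upwards [hev, hr0.eventually_lt_const (half_pos hε)] with k hk hrk z hz
  have hz' : dist z y < ε / 2 := hz
  have htri := dist_triangle_left (c k) y z
  rw [tent_eq_zero (hr k) (by linarith)]
  exact refl_mem_uniformity hV

end tent

theorem exists_seq_of_not_isCompact {X : Type*} [MetricSpace X] {S : Set X} (hS : IsClosed S)
    (hS' : ¬ IsCompact S) (x₀ : X) :
    ∃ x : ℕ → X, (∀ k, x k ∈ S) ∧ (∀ k, x k ≠ x₀) ∧
      ∀ y, ∃ ε > 0, ∀ᶠ k in atTop, ε ≤ dist (x k) y := by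
  rw [isCompact_iff_isSeqCompact, IsSeqCompact] at hS'
  push Not at hS'
  obtain ⟨x, hxS, hx⟩ := hS'
  have hsep (y : X) : ∃ ε > 0, ∀ᶠ k in atTop, ε ≤ dist (x k) y := by
    by_contra! hcon
    have hfreq : MapClusterPt y atTop x := by
      refine Metric.nhds_basis_ball.mapClusterPt_iff_frequently.2 fun ε hε => ?_
      simpa using hcon ε hε
    obtain ⟨φ, hφ, hlim⟩ := hfreq.tendsto_subseq
    exact hx y (hS.mem_of_tendsto hlim (Eventually.of_forall fun k => hxS _)) φ hφ hlim
  obtain ⟨ε, hε, hev⟩ := hsep x₀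
  obtain ⟨K, hK⟩ := eventually_atTop.1 hev
  refine ⟨fun k => x (k + K), fun k => hxS _, fun k (h : x (k + K) = x₀) => ?_, fun y => ?_⟩
  · have := hK (k + K) (Nat.le_add_left K k)
    rw [h, dist_self] at this
    exact this.not_gt hε
  · obtain ⟨δ, hδ, hev⟩ := hsep y
    exact ⟨δ, hδ, (tendsto_add_atTop_nat K).eventually hev⟩

theorem exists_forall_mem_nhds_not_isCompact {X : Type*} [TopologicalSpace X] [R1Space X]
    (hX : ¬ LocallyCompactSpace X) : ∃ x₀ : X, ∀ S ∈ 𝓝 x₀, ¬ IsCompact S := by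
  by_contra! hcon
  have : WeaklyLocallyCompactSpace X :=
    ⟨fun x => (hcon x).imp fun S hS => ⟨hS.2, hS.1⟩⟩
  exact hX inferInstance

theorem exists_isClosedEmbedding_arensSpace {X : Type*} [MetricSpace X]
    (hX : ¬ LocallyCompactSpace X) :
    ∃ e : ArensSpace → C(X, ℝ), IsClosedEmbedding e := by
  obtain ⟨x₀, hx₀⟩ := exists_forall_mem_nhds_not_isCompact hX
  have hseq (n : ℕ) := exists_seq_of_not_isCompact Metric.isClosed_closedBall
    (hx₀ _ (Metric.closedBall_mem_nhds x₀ (Nat.one_div_pos_of_nat (α := ℝ) (n := n)))) x₀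
  choose x hxmem hxne hxsep using hseq
  let r (n k : ℕ) : ℝ := min (dist x₀ (x n k)) (1 / ((k : ℝ) + 1))
  have hrpos (n k : ℕ) : 0 < r n k :=
    lt_min (dist_pos.2 (hxne n k).symm) Nat.one_div_pos_of_nat
  have hrlim (n : ℕ) : Tendsto (r n) atTop (𝓝 0) :=
    squeeze_zero (fun k => (hrpos n k).le) (fun k => min_le_right _ _)
      tendsto_one_div_add_atTop_nhds_zero_nat
  let u (n k : ℕ) : C(X, ℝ) := tent ((k : ℝ) + 1) (r n k) (x n k)
  have hu (n : ℕ) : Tendsto (u n) atTop (𝓝 0) :=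
    tendsto_tent_zero (hrpos n) (hrlim n) (hxsep n)
  have hu₀ (n k : ℕ) : u n k x₀ = 0 := tent_eq_zero (hrpos n k) (min_le_left _ _)
  have hpeak (n k : ℕ) : u n k (x n k) = k + 1 := tent_self
  have hle (n k : ℕ) (y : X) : u n k y ≤ k + 1 := tent_le (by positivity) (hrpos n k).le
  have hsmall {ε : ℝ} (hε : 0 < ε) : ∀ᶠ n : ℕ in atTop, ∀ k, dist (x n k) x₀ < ε := by
    filter_upwards [(tendsto_one_div_add_atTop_nhds_zero_nat (𝕜 := ℝ)).eventually_lt_const hε]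
      with n hn k
    exact (Metric.mem_closedBall.1 (hxmem n k)).trans_lt hn
  have hx (U : Set X) (hU : U ∈ 𝓝 x₀) : ∀ᶠ n in atTop, ∀ k, x n k ∈ U := by
    obtain ⟨ε, hε, hball⟩ := Metric.mem_nhds_iff.1 hU
    exact (hsmall hε).mono fun n hn k => hball (hn k)
  have hzero (y : X) : ∀ᶠ n in atTop, ∀ k, u n k y = 0 := by
    rcases eq_or_ne y x₀ with rfl | hy
    · exact Eventually.of_forall fun n k => hu₀ n k
    · filter_upwards [hsmall (half_pos (dist_pos.2 hy))] with n hn k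
      refine tent_eq_zero (hrpos n k) ((min_le_left _ _).trans ?_)
      have h₁ := hn k
      have h₂ := dist_triangle y (x n k) x₀
      rw [dist_comm x₀]
      linarith
  exact ⟨arensMap u, .of_continuous_injective_isClosedMap (continuous_arensMap hu)
    (injective_arensMap hu₀ hpeak hle) (isClosedMap_arensMap hu hzero hx hpeak)⟩

/-- If `X` is metrizable but not locally compact, then `C_k(X) = C(X, ℝ)` with the
compact-open topology contains a closed copy of the Arens space `S₂`; in particular,
`C_k(X)` does not have property AP. -/
theorem Ck_contains_closed_Arens
    (X : Type*) [TopologicalSpace X] [TopologicalSpace.MetrizableSpace X]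
    (hX : ¬ LocallyCompactSpace X) :
    (∃ e : ArensSpace → C(X, ℝ), Topology.IsClosedEmbedding e) ∧
      ¬ HasPropertyAP C(X, ℝ) := by
  let _ := TopologicalSpace.metrizableSpaceMetric X
  obtain ⟨e, he⟩ := exists_isClosedEmbedding_arensSpace hX
  exact ⟨⟨e, he⟩, fun h => ArensSpace.not_hasPropertyAP (h.of_isClosedEmbedding he)⟩
end
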